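/- (Stationary points are globally optimal.) Suppose K ∈ 𝕂 satisfies ∇C(K) = 0. Then L^K_i = 0 for every i = 1,…,N, the tuple P^K satisfies the coupled algebraic Riccati equations P_i = Q_i + A_iᵀ E_i(P) A_i − A_iᵀ E_i(P) B_i (R_i + B_iᵀ E_i(P) B_i)^{−1} B_iᵀ E_i(P) A_i, and C(K) ≤ C(K') for every K' ∈ 𝕂. -/

import Mathlib

open Matrix Filter
open scoped Kronecker Topology

namespace MJLS

noncomputable section

attribute [local instance] Classical.propDecidable

/-- Closed-loop matrices `Γ i = A i - B i * K i`. -/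
def Gam {d k N : ℕ} (A : Fin N → Matrix (Fin d) (Fin d) ℝ)
    (B : Fin N → Matrix (Fin d) (Fin k) ℝ)
    (K : Fin N → Matrix (Fin k) (Fin d) ℝ) : Fin N → Matrix (Fin d) (Fin d) ℝ :=
  fun i => A i - B i * K i

/-- The operator `E_i(V) = ∑ j, p i j • V j`. -/
def opE {d N : ℕ} (Pr : Matrix (Fin N) (Fin N) ℝ)
    (V : Fin N → Matrix (Fin d) (Fin d) ℝ) : Fin N → Matrix (Fin d) (Fin d) ℝ :=
  fun i => ∑ j, Pr i j • V j

/-- The matrix `𝒜 = diag(Γᵀ ⊗ Γᵀ) (P ⊗ I)`. -/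
def calA {d N : ℕ} (Pr : Matrix (Fin N) (Fin N) ℝ)
    (Γ : Fin N → Matrix (Fin d) (Fin d) ℝ) :
    Matrix (Fin N × Fin d × Fin d) (Fin N × Fin d × Fin d) ℝ :=
  (Matrix.reindex (Equiv.prodComm (Fin d × Fin d) (Fin N))
      (Equiv.prodComm (Fin d × Fin d) (Fin N))
      (Matrix.blockDiagonal fun i => (Γ i)ᵀ ⊗ₖ (Γ i)ᵀ)) *
    (Pr ⊗ₖ (1 : Matrix (Fin d × Fin d) (Fin d × Fin d) ℝ))

/-- `K` is mean-square stabilizing: the spectral radius of `𝒜` is less than `1`. -/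
def MSS {d k N : ℕ} (Pr : Matrix (Fin N) (Fin N) ℝ)
    (A : Fin N → Matrix (Fin d) (Fin d) ℝ) (B : Fin N → Matrix (Fin d) (Fin k) ℝ)
    (K : Fin N → Matrix (Fin k) (Fin d) ℝ) : Prop :=
  spectralRadius ℂ ((calA Pr (Gam A B K)).map (algebraMap ℝ ℂ)) < 1

/-- `P` solves the coupled Lyapunov equations for the policy `K`. -/
def IsLyap {d k N : ℕ} (Pr : Matrix (Fin N) (Fin N) ℝ)
    (A : Fin N → Matrix (Fin d) (Fin d) ℝ) (B : Fin N → Matrix (Fin d) (Fin k) ℝ)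
    (Q : Fin N → Matrix (Fin d) (Fin d) ℝ) (R : Fin N → Matrix (Fin k) (Fin k) ℝ)
    (K : Fin N → Matrix (Fin k) (Fin d) ℝ)
    (P : Fin N → Matrix (Fin d) (Fin d) ℝ) : Prop :=
  ∀ i, P i = Q i + (K i)ᵀ * R i * K i + (Gam A B K i)ᵀ * opE Pr P i * Gam A B K i

/-- `P^K`, the (for mean-square stabilizing `K`, unique) solution of the coupled
Lyapunov equations. -/
def PK {d k N : ℕ} (Pr : Matrix (Fin N) (Fin N) ℝ)
    (A : Fin N → Matrix (Fin d) (Fin d) ℝ) (B : Fin N → Matrix (Fin d) (Fin k) ℝ)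
    (Q : Fin N → Matrix (Fin d) (Fin d) ℝ) (R : Fin N → Matrix (Fin k) (Fin k) ℝ)
    (K : Fin N → Matrix (Fin k) (Fin d) ℝ) : Fin N → Matrix (Fin d) (Fin d) ℝ :=
  if h : ∃ P, IsLyap Pr A B Q R K P then h.choose else 0

/-- The LQR cost `C(K) = ∑ i, π i * tr(P^K_i Sg)`. -/
def cost {d k N : ℕ} (Pr : Matrix (Fin N) (Fin N) ℝ)
    (A : Fin N → Matrix (Fin d) (Fin d) ℝ) (B : Fin N → Matrix (Fin d) (Fin k) ℝ)
    (Q : Fin N → Matrix (Fin d) (Fin d) ℝ) (R : Fin N → Matrix (Fin k) (Fin k) ℝ)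
    (piv : Fin N → ℝ) (Sg : Matrix (Fin d) (Fin d) ℝ)
    (K : Fin N → Matrix (Fin k) (Fin d) ℝ) : ℝ :=
  ∑ i, piv i * (PK Pr A B Q R K i * Sg).trace

/-- The operator `T_j(V) = ∑ i, p i j • (Γ i * V i * Γ iᵀ)`. -/
def opT {d N : ℕ} (Pr : Matrix (Fin N) (Fin N) ℝ)
    (Γ : Fin N → Matrix (Fin d) (Fin d) ℝ)
    (V : Fin N → Matrix (Fin d) (Fin d) ℝ) : Fin N → Matrix (Fin d) (Fin d) ℝ :=
  fun j => ∑ i, Pr i j • (Γ i * V i * (Γ i)ᵀ)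

/-- `𝐗^K = ∑_{t=0}^∞ T^t(X(0))` with `X_i(0) = π i • Sg`. -/
def XK {d N : ℕ} (Pr : Matrix (Fin N) (Fin N) ℝ) (piv : Fin N → ℝ)
    (Sg : Matrix (Fin d) (Fin d) ℝ) (Γ : Fin N → Matrix (Fin d) (Fin d) ℝ) :
    Fin N → Matrix (Fin d) (Fin d) ℝ :=
  ∑' t : ℕ, (opT Pr Γ)^[t] (fun i => piv i • Sg)

/-- `L^K_i = (R i + B iᵀ E_i(P^K) B i) K i - B iᵀ E_i(P^K) A i`. -/
def LK {d k N : ℕ} (Pr : Matrix (Fin N) (Fin N) ℝ)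
    (A : Fin N → Matrix (Fin d) (Fin d) ℝ) (B : Fin N → Matrix (Fin d) (Fin k) ℝ)
    (Q : Fin N → Matrix (Fin d) (Fin d) ℝ) (R : Fin N → Matrix (Fin k) (Fin k) ℝ)
    (K : Fin N → Matrix (Fin k) (Fin d) ℝ) : Fin N → Matrix (Fin k) (Fin d) ℝ :=
  fun i => (R i + (B i)ᵀ * opE Pr (PK Pr A B Q R K) i * B i) * K i
    - (B i)ᵀ * opE Pr (PK Pr A B Q R K) i * A i

/-- The operator `L_i(V) = Γ iᵀ E_i(V) Γ i`. -/
def opL {d N : ℕ} (Pr : Matrix (Fin N) (Fin N) ℝ)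
    (Γ : Fin N → Matrix (Fin d) (Fin d) ℝ)
    (V : Fin N → Matrix (Fin d) (Fin d) ℝ) : Fin N → Matrix (Fin d) (Fin d) ℝ :=
  fun i => (Γ i)ᵀ * opE Pr V i * Γ i

/-- `(P^K)'[E] = ∑_{t=0}^∞ L^t(Eᵀ L^K + (L^K)ᵀ E)`. -/
def PKd {d k N : ℕ} (Pr : Matrix (Fin N) (Fin N) ℝ)
    (Γ : Fin N → Matrix (Fin d) (Fin d) ℝ)
    (Lk E : Fin N → Matrix (Fin k) (Fin d) ℝ) : Fin N → Matrix (Fin d) (Fin d) ℝ :=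
  ∑' t : ℕ, (opL Pr Γ)^[t] (fun i => (E i)ᵀ * Lk i + (Lk i)ᵀ * E i)

/-- `‖V‖₂² = ∑ i, tr(V iᵀ V i)`. -/
def norm2sq {a b N : ℕ} (V : Fin N → Matrix (Fin a) (Fin b) ℝ) : ℝ :=
  ∑ i, ((V i)ᵀ * V i).trace

/-- The inner product `⟨V, S⟩ = ∑ i, tr(V iᵀ S i)`. -/
def ip {a b N : ℕ} (V S : Fin N → Matrix (Fin a) (Fin b) ℝ) : ℝ :=
  ∑ i, ((V i)ᵀ * S i).trace

/-- The spectral norm (maximal singular value) of a matrix. -/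
def specNorm {a b : ℕ} (M : Matrix (Fin a) (Fin b) ℝ) : ℝ :=
  ⨆ x : {x : EuclideanSpace ℝ (Fin b) // ‖x‖ ≤ 1}, ‖Matrix.toEuclideanLin M x.1‖

/-- The minimal singular value of a square matrix. -/
def sigmaMin {a : ℕ} (M : Matrix (Fin a) (Fin a) ℝ) : ℝ :=
  ⨅ x : {x : EuclideanSpace ℝ (Fin a) // ‖x‖ = 1}, ‖Matrix.toEuclideanLin M x.1‖

/-- `‖V‖_max = max_i ‖V i‖` (spectral norms). -/
def maxNorm {a b N : ℕ} (V : Fin N → Matrix (Fin a) (Fin b) ℝ) : ℝ :=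
  ⨆ i, specNorm (V i)

/-- `Λ_min(V) = min_i σ_min(V i)`. -/
def lamMin {a N : ℕ} (V : Fin N → Matrix (Fin a) (Fin a) ℝ) : ℝ :=
  ⨅ i, sigmaMin (V i)

/-- `μ = (min_i π i) · σ_min(Sg)`. -/
def mu {d N : ℕ} (piv : Fin N → ℝ) (Sg : Matrix (Fin d) (Fin d) ℝ) : ℝ :=
  (⨅ i, piv i) * sigmaMin Sg

/-- `ξ(α) = (1/Λ_min(Q))·((1 + ‖B‖²_max)·α/μ + ‖R‖_max) − 1`. -/
def xi {d k N : ℕ} (B : Fin N → Matrix (Fin d) (Fin k) ℝ)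
    (R : Fin N → Matrix (Fin k) (Fin k) ℝ) (Q : Fin N → Matrix (Fin d) (Fin d) ℝ)
    (piv : Fin N → ℝ) (Sg : Matrix (Fin d) (Fin d) ℝ) (α : ℝ) : ℝ :=
  (1 / lamMin Q) * ((1 + maxNorm B ^ 2) * α / mu piv Sg + maxNorm R) - 1

/-- The smoothness constant
`L(α) = 2·(‖R‖_max + ‖B‖²_max·(1 + 2ξ(α)/‖B‖_max)·α/μ)·α/Λ_min(Q)`. -/
def Lsm {d k N : ℕ} (B : Fin N → Matrix (Fin d) (Fin k) ℝ)
    (R : Fin N → Matrix (Fin k) (Fin k) ℝ) (Q : Fin N → Matrix (Fin d) (Fin d) ℝ)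
    (piv : Fin N → ℝ) (Sg : Matrix (Fin d) (Fin d) ℝ) (α : ℝ) : ℝ :=
  2 * (maxNorm R + maxNorm B ^ 2 * (1 + 2 * xi B R Q piv Sg α / maxNorm B)
      * α / mu piv Sg) * α / lamMin Q

end

section GelfandAux

attribute [local instance] Matrix.linftyOpNormedRing Matrix.linftyOpNormedAlgebra

lemma pow_entry_tendsto {n : Type} [Fintype n] [DecidableEq n] (M : Matrix n n ℝ)
    (h : spectralRadius ℂ (M.map (algebraMap ℝ ℂ)) < 1) (a b : n) :
    Tendsto (fun t : ℕ => (M ^ t) a b) atTop (𝓝 0) := by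
  set c := M.map (algebraMap ℝ ℂ) with hc
  have : CompleteSpace (Matrix n n ℂ) := FiniteDimensional.complete ℂ _
  have hg := spectrum.pow_nnnorm_pow_one_div_tendsto_nhds_spectralRadius c
  obtain ⟨r, hr1, hr2⟩ := ENNReal.lt_iff_exists_nnreal_btwn.1 h
  have hr2' : r < 1 := by exact_mod_cast hr2
  have hev : ∀ᶠ t : ℕ in atTop, ‖c ^ t‖ ≤ (r : ℝ) ^ t := by
    filter_upwards [hg.eventually_lt_const hr1, eventually_gt_atTop 0] with t ht ht0
    have h1 : ((‖c ^ t‖₊ : ENNReal) ^ (1 / t : ℝ)) ^ (t : ℝ) ≤ (r : ENNReal) ^ (t : ℝ) :=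
      ENNReal.rpow_le_rpow ht.le (by positivity)
    rw [← ENNReal.rpow_mul, one_div_mul_cancel (by positivity), ENNReal.rpow_one,
      ENNReal.rpow_natCast] at h1
    have h2 : ‖c ^ t‖₊ ≤ r ^ t := by exact_mod_cast h1
    exact_mod_cast h2
  have hent : ∀ t, ‖(M ^ t) a b‖ ≤ ‖c ^ t‖ := by
    intro t
    have e : c ^ t = (M ^ t).map (algebraMap ℝ ℂ) := by
      rw [hc, Matrix.map_pow]
    have h3 : ‖(M ^ t) a b‖ = ‖(c ^ t) a b‖ := by
      rw [e]; simp
    rw [h3, Matrix.linfty_opNorm_def]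
    have h4 : ‖(c ^ t) a b‖₊ ≤ Finset.univ.sup fun i => ∑ j, ‖(c ^ t) i j‖₊ := by
      refine le_trans ?_ (Finset.le_sup (f := fun i => ∑ j, ‖(c ^ t) i j‖₊) (Finset.mem_univ a))
      exact Finset.single_le_sum (f := fun j => ‖(c ^ t) a j‖₊) (fun _ _ => zero_le) (Finset.mem_univ b)
    exact_mod_cast h4
  refine squeeze_zero_norm' ?_ (tendsto_pow_atTop_nhds_zero_of_lt_one r.2 hr2')
  filter_upwards [hev] with t ht
  exact (hent t).trans ht

end GelfandAux

/-- Stacking a tuple of matrices into one vector. -/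
def vecT {d N : ℕ} (V : Fin N → Matrix (Fin d) (Fin d) ℝ) : Fin N × Fin d × Fin d → ℝ :=
  fun x => V x.1 x.2.1 x.2.2

lemma calA_mulVec {d N : ℕ} (Pr : Matrix (Fin N) (Fin N) ℝ)
    (Γ V : Fin N → Matrix (Fin d) (Fin d) ℝ) :
    calA Pr Γ *ᵥ vecT V = vecT (opL Pr Γ V) := by
  unfold calA
  rw [← Matrix.mulVec_mulVec]
  have h1 : (Pr ⊗ₖ (1 : Matrix (Fin d × Fin d) (Fin d × Fin d) ℝ)) *ᵥ vecT V = vecT (opE Pr V) := by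
    ext ⟨i, a, b⟩
    simp only [Matrix.mulVec, dotProduct, vecT, opE, Fintype.sum_prod_type, kroneckerMap_apply,
      Matrix.one_apply, Matrix.sum_apply, Matrix.smul_apply, smul_eq_mul]
    refine Finset.sum_congr rfl fun j _ => ?_
    simp [Prod.ext_iff, ite_and]
  rw [h1]
  ext ⟨i, a, b⟩
  simp only [Matrix.mulVec, dotProduct, vecT, opL, Fintype.sum_prod_type, Matrix.reindex_apply,
    Matrix.submatrix_apply, Equiv.prodComm_symm, Equiv.prodComm_apply, Prod.swap_prod_mk,
    Matrix.blockDiagonal_apply, kroneckerMap_apply, Matrix.mul_apply, Matrix.transpose_apply]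
  rw [Finset.sum_eq_single i]
  · simp only [if_true, Finset.sum_mul]
    rw [Finset.sum_comm]
    refine Finset.sum_congr rfl fun _ _ => Finset.sum_congr rfl fun _ _ => by ring
  · intro j _ hj
    simp [Ne.symm hj]
  · simp

/-- Iterates of `opL` tend to zero. -/
def Stab {d N : ℕ} (Pr : Matrix (Fin N) (Fin N) ℝ)
    (Γ : Fin N → Matrix (Fin d) (Fin d) ℝ) : Prop :=
  ∀ V i a b, Tendsto (fun t : ℕ => (opL Pr Γ)^[t] V i a b) atTop (𝓝 0)

lemma stab_of_MSS {d k N : ℕ} {Pr : Matrix (Fin N) (Fin N) ℝ}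
    {A : Fin N → Matrix (Fin d) (Fin d) ℝ} {B : Fin N → Matrix (Fin d) (Fin k) ℝ}
    {K : Fin N → Matrix (Fin k) (Fin d) ℝ} (h : MSS Pr A B K) : Stab Pr (Gam A B K) := by
  intro V i a b
  have hp : ∀ t : ℕ, vecT ((opL Pr (Gam A B K))^[t] V) = (calA Pr (Gam A B K)) ^ t *ᵥ vecT V := by
    intro t
    induction t with
    | zero => simp
    | succ t ih => rw [Function.iterate_succ_apply', ← calA_mulVec, ih, pow_succ', Matrix.mulVec_mulVec]
  have h2 : ∀ t : ℕ, (opL Pr (Gam A B K))^[t] V i a b =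
      ∑ x, ((calA Pr (Gam A B K)) ^ t) (i, a, b) x * vecT V x := fun t => by
    have := congrFun (hp t) (i, a, b)
    simpa [vecT, Matrix.mulVec, dotProduct] using this
  simp only [h2]
  have : Tendsto (fun t : ℕ => ∑ x, ((calA Pr (Gam A B K)) ^ t) (i, a, b) x * vecT V x) atTop
      (𝓝 (∑ x, 0 * vecT V x)) :=
    tendsto_finsetSum _ fun x _ => (pow_entry_tendsto _ h _ _).mul_const _
  simpa using this

/-- `opL` as a linear map. -/
def linL {d N : ℕ} (Pr : Matrix (Fin N) (Fin N) ℝ) (Γ : Fin N → Matrix (Fin d) (Fin d) ℝ) :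
    (Fin N → Matrix (Fin d) (Fin d) ℝ) →ₗ[ℝ] (Fin N → Matrix (Fin d) (Fin d) ℝ) where
  toFun := opL Pr Γ
  map_add' V W := by
    funext i
    simp [opL, opE, Finset.sum_add_distrib, Matrix.mul_add, Matrix.add_mul]
  map_smul' c V := by
    funext i
    simp only [opL, opE, Pi.smul_apply, RingHom.id_apply, smul_comm _ c, ← Finset.smul_sum,
      Matrix.mul_smul, Matrix.smul_mul]

lemma opL_sub {d N : ℕ} (Pr : Matrix (Fin N) (Fin N) ℝ) (Γ V W : Fin N → Matrix (Fin d) (Fin d) ℝ) :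
    opL Pr Γ (V - W) = opL Pr Γ V - opL Pr Γ W := map_sub (linL Pr Γ) V W

lemma opL_psd {d N : ℕ} {Pr : Matrix (Fin N) (Fin N) ℝ} (hPr : ∀ i j, 0 ≤ Pr i j)
    (Γ : Fin N → Matrix (Fin d) (Fin d) ℝ) {V : Fin N → Matrix (Fin d) (Fin d) ℝ}
    (hV : ∀ i, (V i).PosSemidef) (i : Fin N) : (opL Pr Γ V i).PosSemidef := by
  have hE : (opE Pr V i).PosSemidef :=
    Matrix.posSemidef_sum _ fun j _ => (hV j).smul (hPr i j)
  simpa [opL] using hE.conjTranspose_mul_mul_same (Γ i)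

lemma psd_of_tendsto {d : ℕ} {u : ℕ → Matrix (Fin d) (Fin d) ℝ} {M : Matrix (Fin d) (Fin d) ℝ}
    (hu : ∀ t, (u t).PosSemidef) (hlim : ∀ a b, Tendsto (fun t => u t a b) atTop (𝓝 (M a b))) :
    M.PosSemidef := by
  refine Matrix.PosSemidef.of_dotProduct_mulVec_nonneg ?_ ?_
  · ext a b
    have h := hlim b a
    have h2 : (fun t => u t b a) = fun t => u t a b := by
      funext t
      have := (hu t).1.apply b a
      simpa using this.symm
    rw [h2] at h
    simpa using tendsto_nhds_unique h (hlim a b)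
  · intro x
    have h : Tendsto (fun t => star x ⬝ᵥ (u t *ᵥ x)) atTop (𝓝 (star x ⬝ᵥ (M *ᵥ x))) := by
      simp only [dotProduct, Matrix.mulVec]
      exact tendsto_finsetSum _ fun a _ => Tendsto.const_mul _
        (tendsto_finsetSum _ fun b _ => (hlim a b).mul_const _)
    exact ge_of_tendsto' h fun t => (hu t).dotProduct_mulVec_nonneg x

lemma psd_of_fix {d N : ℕ} {Pr : Matrix (Fin N) (Fin N) ℝ} (hPr : ∀ i j, 0 ≤ Pr i j)
    {Γ : Fin N → Matrix (Fin d) (Fin d) ℝ} (hst : Stab Pr Γ)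
    {V S : Fin N → Matrix (Fin d) (Fin d) ℝ} (hS : ∀ i, (S i).PosSemidef)
    (hV : V = S + opL Pr Γ V) (i : Fin N) : (V i).PosSemidef := by
  have h1 : ∀ t : ℕ, ∀ i, ((V - (opL Pr Γ)^[t] V) i).PosSemidef := by
    intro t
    induction t with
    | zero => intro i; simpa using Matrix.PosSemidef.zero
    | succ t ih =>
      intro i
      have : V - (opL Pr Γ)^[t+1] V = S + opL Pr Γ (V - (opL Pr Γ)^[t] V) := by
        rw [opL_sub, Function.iterate_succ_apply', ← add_sub_assoc, ← hV]
      rw [this]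
      exact (hS i).add (opL_psd hPr Γ ih i)
  refine psd_of_tendsto (fun t => h1 t i) fun a b => ?_
  simpa using (hst V i a b).const_sub (V i a b)

lemma fix_zero {d N : ℕ} {Pr : Matrix (Fin N) (Fin N) ℝ}
    {Γ : Fin N → Matrix (Fin d) (Fin d) ℝ} (hst : Stab Pr Γ)
    {V : Fin N → Matrix (Fin d) (Fin d) ℝ} (hV : opL Pr Γ V = V) : V = 0 := by
  funext i; ext a b
  have h := hst V i a b
  have : ∀ t : ℕ, (opL Pr Γ)^[t] V = V := fun t => Function.iterate_fixed hV t
  simp only [this] at h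
  exact tendsto_nhds_unique tendsto_const_nhds h

lemma trace_mul_nonneg {d : ℕ} {P S : Matrix (Fin d) (Fin d) ℝ} (hP : P.PosSemidef)
    (hS : S.PosSemidef) : 0 ≤ (P * S).trace := by
  obtain ⟨m, v, rfl⟩ := Matrix.posSemidef_iff_eq_sum_vecMulVec.1 hS
  rw [Matrix.mul_sum, Matrix.trace_sum]
  refine Finset.sum_nonneg fun i _ => ?_
  rw [Matrix.mul_vecMulVec, Matrix.trace_vecMulVec, dotProduct_comm]
  exact hP.dotProduct_mulVec_nonneg (v i)

lemma eq_zero_of_trace {d k : ℕ} {S : Matrix (Fin d) (Fin d) ℝ} (hS : S.PosDef)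
    {L : Matrix (Fin k) (Fin d) ℝ} (h : (Lᵀ * L * S).trace = 0) : L = 0 := by
  have h1 : (L * S * Lᴴ).trace = 0 := by
    rw [Matrix.trace_mul_comm, ← Matrix.mul_assoc]; simpa using h
  have h2 := ((hS.posSemidef.mul_mul_conjTranspose_same L).trace_eq_zero_iff).1 h1
  ext a b
  by_contra hne
  have hx : L a ≠ 0 := fun h0 => hne (by simp [h0])
  have h3 := hS.dotProduct_mulVec_pos hx
  have h4 : (L * S * Lᴴ) a a = star (L a) ⬝ᵥ (S *ᵥ L a) := by
    rw [Matrix.mul_assoc, Matrix.mul_apply]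
    simp [dotProduct, Matrix.mulVec, Matrix.mul_apply]
  rw [h2] at h4
  simp only [Matrix.zero_apply] at h4
  linarith

lemma isLyap_iff {d k N : ℕ} {Pr : Matrix (Fin N) (Fin N) ℝ}
    {A : Fin N → Matrix (Fin d) (Fin d) ℝ} {B : Fin N → Matrix (Fin d) (Fin k) ℝ}
    {Q : Fin N → Matrix (Fin d) (Fin d) ℝ} {R : Fin N → Matrix (Fin k) (Fin k) ℝ}
    {K : Fin N → Matrix (Fin k) (Fin d) ℝ} {P : Fin N → Matrix (Fin d) (Fin d) ℝ} :
    IsLyap Pr A B Q R K P ↔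
      P = (fun i => Q i + (K i)ᵀ * R i * K i) + opL Pr (Gam A B K) P :=
  ⟨fun h => funext h, fun h i => congrFun h i⟩

lemma PK_spec {d k N : ℕ} {Pr : Matrix (Fin N) (Fin N) ℝ}
    {A : Fin N → Matrix (Fin d) (Fin d) ℝ} {B : Fin N → Matrix (Fin d) (Fin k) ℝ}
    {Q : Fin N → Matrix (Fin d) (Fin d) ℝ} {R : Fin N → Matrix (Fin k) (Fin k) ℝ}
    {K : Fin N → Matrix (Fin k) (Fin d) ℝ}
    (h : ∃ P, IsLyap Pr A B Q R K P) : IsLyap Pr A B Q R K (PK Pr A B Q R K) := by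
  unfold PK
  rw [dif_pos h]
  exact h.choose_spec

lemma exists_fix {d N : ℕ} {Pr : Matrix (Fin N) (Fin N) ℝ}
    {Γ : Fin N → Matrix (Fin d) (Fin d) ℝ} (hst : Stab Pr Γ)
    (S : Fin N → Matrix (Fin d) (Fin d) ℝ) : ∃ V, V = S + opL Pr Γ V := by
  have hinj : Function.Injective ((LinearMap.id : (Fin N → Matrix (Fin d) (Fin d) ℝ) →ₗ[ℝ] _) - linL Pr Γ) := by
    rw [← LinearMap.ker_eq_bot, LinearMap.ker_eq_bot']
    intro V hV
    refine fix_zero hst ?_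
    have : V - opL Pr Γ V = 0 := hV
    exact (sub_eq_zero.1 this).symm
  obtain ⟨V, hV⟩ := LinearMap.injective_iff_surjective.1 hinj S
  have hV' : V - opL Pr Γ V = S := hV
  exact ⟨V, by rw [← hV']; simp⟩

/-- The key comparison identity. -/
lemma diff_identity {d k N : ℕ} {Pr : Matrix (Fin N) (Fin N) ℝ}
    {A : Fin N → Matrix (Fin d) (Fin d) ℝ} {B : Fin N → Matrix (Fin d) (Fin k) ℝ}
    {Q : Fin N → Matrix (Fin d) (Fin d) ℝ} {R : Fin N → Matrix (Fin k) (Fin k) ℝ}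
    (hR : ∀ i, (R i)ᵀ = R i)
    {K K' : Fin N → Matrix (Fin k) (Fin d) ℝ} {P P' : Fin N → Matrix (Fin d) (Fin d) ℝ}
    (hPs : ∀ i, (opE Pr P i)ᵀ = opE Pr P i)
    (hP : IsLyap Pr A B Q R K P) (hP' : IsLyap Pr A B Q R K' P') (i : Fin N) :
    P' i - P i = (K' i - K i)ᵀ * ((R i + (B i)ᵀ * opE Pr P i * B i) * K i
        - (B i)ᵀ * opE Pr P i * A i) +
      ((R i + (B i)ᵀ * opE Pr P i * B i) * K i - (B i)ᵀ * opE Pr P i * A i)ᵀ * (K' i - K i) +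
      (K' i - K i)ᵀ * (R i + (B i)ᵀ * opE Pr P i * B i) * (K' i - K i) +
      opL Pr (Gam A B K') (P' - P) i := by
  rw [opL_sub, Pi.sub_apply]
  conv_lhs => rw [hP i, hP' i]
  simp only [opL, Gam]
  simp only [Matrix.transpose_sub, Matrix.transpose_add, Matrix.transpose_mul, hR, hPs,
    Matrix.transpose_transpose, Matrix.mul_sub, Matrix.sub_mul, Matrix.mul_add, Matrix.add_mul,
    Matrix.mul_assoc]
  abel

lemma abstract_solve {X W : Type} [NormedAddCommGroup X] [NormedSpace ℝ X]
    [NormedAddCommGroup W] [NormedSpace ℝ W] [FiniteDimensional ℝ W]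
    (l : X → W →ₗ[ℝ] W) (c : X → W) (x0 : X)
    (hl : ∀ v, ContDiff ℝ 1 (fun x => l x v)) (hc : ContDiff ℝ 1 c)
    (hinj : ∀ v, l x0 v = 0 → v = 0) :
    ∃ g : X → W, DifferentiableAt ℝ g x0 ∧ ∀ᶠ x in 𝓝 x0, ∀ v, l x v = c x ↔ v = g x := by
  have : CompleteSpace W := FiniteDimensional.complete ℝ W
  let F : X → (W →L[ℝ] W) := fun x => LinearMap.toContinuousLinearMap (l x)
  have hF : ContDiff ℝ 1 F := contDiff_clm_apply_iff.2 hl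
  have hunit : IsUnit (F x0) := by
    rw [ContinuousLinearMap.isUnit_iff_bijective]
    have hi : Function.Injective (l x0) := by
      rw [← LinearMap.ker_eq_bot, LinearMap.ker_eq_bot']
      exact hinj
    exact ⟨hi, LinearMap.injective_iff_surjective.1 hi⟩
  have hev : ∀ᶠ x in 𝓝 x0, IsUnit (F x) :=
    hF.continuous.continuousAt.eventually (Units.isOpen.mem_nhds hunit)
  refine ⟨fun x => Ring.inverse (F x) (c x), ?_, ?_⟩
  · have hFd : DifferentiableAt ℝ F x0 := (hF.differentiable one_ne_zero) x0
    have hcd : DifferentiableAt ℝ c x0 := (hc.differentiable one_ne_zero) x0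
    have h3 : DifferentiableAt ℝ (fun x => Ring.inverse (F x)) x0 :=
      DifferentiableAt.comp x0 (differentiableAt_inverse hunit) hFd
    exact h3.clm_apply hcd
  · filter_upwards [hev] with x hx v
    constructor
    · intro h
      have h2 : F x v = c x := h
      rw [← h2]
      exact (congrArg (fun T : W →L[ℝ] W => T v) (Ring.inverse_mul_cancel _ hx)).symm
    · rintro rfl
      exact congrArg (fun T : W →L[ℝ] W => T (c x)) (Ring.mul_inverse_cancel _ hx)

lemma curve_deriv {X : Type} [NormedAddCommGroup X] [NormedSpace ℝ X] (K E : X) :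
    HasDerivAt (fun t : ℝ => K + t • E) E 0 := by
  simpa using ((hasDerivAt_id (0 : ℝ)).smul_const E).const_add K

lemma curve_tendsto {X : Type} [NormedAddCommGroup X] [NormedSpace ℝ X] (K E : X) :
    Tendsto (fun t : ℝ => K + t • E) (𝓝 0) (𝓝 K) := by
  simpa using (curve_deriv K E).continuousAt.tendsto

section DiffAux

attribute [local instance] Matrix.normedAddCommGroup Matrix.normedSpace

lemma contDiff_entry {d k N : ℕ} (i : Fin N) (a : Fin k) (b : Fin d) :
    ContDiff ℝ 1 (fun K : Fin N → Matrix (Fin k) (Fin d) ℝ => K i a b) :=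
  contDiff_pi.1 (contDiff_pi.1 (contDiff_pi.1 contDiff_id i) a) b

lemma contDiff_of_entries {d N : ℕ} {X : Type} [NormedAddCommGroup X] [NormedSpace ℝ X]
    {f : X → Fin N → Matrix (Fin d) (Fin d) ℝ}
    (h : ∀ i a b, ContDiff ℝ 1 (fun x => f x i a b)) : ContDiff ℝ 1 f :=
  contDiff_pi.2 fun i => contDiff_pi.2 fun a => contDiff_pi.2 fun b => h i a b

lemma PK_differentiableAt {d k N : ℕ} {Pr : Matrix (Fin N) (Fin N) ℝ}
    {A : Fin N → Matrix (Fin d) (Fin d) ℝ} {B : Fin N → Matrix (Fin d) (Fin k) ℝ}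
    (Q : Fin N → Matrix (Fin d) (Fin d) ℝ) (R : Fin N → Matrix (Fin k) (Fin k) ℝ)
    {K : Fin N → Matrix (Fin k) (Fin d) ℝ} (hst : Stab Pr (Gam A B K)) :
    DifferentiableAt ℝ (PK Pr A B Q R) K ∧
      ∀ᶠ K' in 𝓝 K, IsLyap Pr A B Q R K' (PK Pr A B Q R K') := by
  let c : (Fin N → Matrix (Fin k) (Fin d) ℝ) → Fin N → Matrix (Fin d) (Fin d) ℝ :=
    fun K' i => Q i + (K' i)ᵀ * R i * K' i
  have he := contDiff_entry (d := d) (k := k) (N := N)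
  obtain ⟨g, hg, hev⟩ := abstract_solve (fun K' => LinearMap.id - linL Pr (Gam A B K')) c K
    (fun V => by
      refine contDiff_of_entries fun i a b => ?_
      have : ∀ K', ((LinearMap.id : (Fin N → Matrix (Fin d) (Fin d) ℝ) →ₗ[ℝ] _) -
          linL Pr (Gam A B K')) V = V - opL Pr (Gam A B K') V :=
        fun K' => rfl
      simp only [this, Pi.sub_apply, Matrix.sub_apply, opL, Gam, Matrix.mul_apply,
        Matrix.transpose_apply]
      fun_prop)
    (by
      refine contDiff_of_entries fun i a b => ?_
      simp only [c, Matrix.add_apply, Matrix.mul_apply, Matrix.transpose_apply]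
      fun_prop)
    (fun V hV => fix_zero hst (by
      have : V - opL Pr (Gam A B K) V = 0 := hV
      exact (sub_eq_zero.1 this).symm))
  have hev2 : ∀ᶠ K' in 𝓝 K, IsLyap Pr A B Q R K' (PK Pr A B Q R K') ∧
      PK Pr A B Q R K' = g K' := by
    refine Filter.Eventually.mono hev fun K' h => ?_
    have h' : ∀ V, IsLyap Pr A B Q R K' V ↔ V = g K' := fun V => by
      rw [← h V, isLyap_iff]
      exact sub_eq_iff_eq_add.symm
    have h1 : IsLyap Pr A B Q R K' (PK Pr A B Q R K') := PK_spec ⟨g K', (h' _).2 rfl⟩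
    exact ⟨h1, (h' _).1 h1⟩
  exact ⟨hg.congr_of_eventuallyEq (hev2.mono fun K' h => h.2), hev2.mono fun K' h => h.1⟩

lemma lyap_psd {d k N : ℕ} {Pr : Matrix (Fin N) (Fin N) ℝ} (hPr : ∀ i j, 0 ≤ Pr i j)
    {A : Fin N → Matrix (Fin d) (Fin d) ℝ} {B : Fin N → Matrix (Fin d) (Fin k) ℝ}
    {Q : Fin N → Matrix (Fin d) (Fin d) ℝ} {R : Fin N → Matrix (Fin k) (Fin k) ℝ}
    (hQ : ∀ i, (Q i).PosDef) (hR : ∀ i, (R i).PosDef)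
    {K : Fin N → Matrix (Fin k) (Fin d) ℝ} (hst : Stab Pr (Gam A B K))
    {P : Fin N → Matrix (Fin d) (Fin d) ℝ} (h : IsLyap Pr A B Q R K P) (i : Fin N) :
    (P i).PosSemidef := by
  refine psd_of_fix hPr hst (fun i => ?_) (isLyap_iff.1 h) i
  refine (hQ i).posSemidef.add ?_
  simpa using (hR i).posSemidef.conjTranspose_mul_mul_same (K i)

/-- The directional derivative of `PK` solves a Lyapunov equation. -/
lemma deriv_eq {d k N : ℕ} {Pr : Matrix (Fin N) (Fin N) ℝ}
    {A : Fin N → Matrix (Fin d) (Fin d) ℝ} {B : Fin N → Matrix (Fin d) (Fin k) ℝ}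
    {Q : Fin N → Matrix (Fin d) (Fin d) ℝ} {R : Fin N → Matrix (Fin k) (Fin k) ℝ}
    (hR : ∀ i, (R i)ᵀ = R i) {K : Fin N → Matrix (Fin k) (Fin d) ℝ}
    (hst : Stab Pr (Gam A B K))
    (hPs : ∀ i, (opE Pr (PK Pr A B Q R K) i)ᵀ = opE Pr (PK Pr A B Q R K) i)
    (E : Fin N → Matrix (Fin k) (Fin d) ℝ) :
    fderiv ℝ (PK Pr A B Q R) K E =
      (fun i => (E i)ᵀ * LK Pr A B Q R K i + (LK Pr A B Q R K i)ᵀ * E i) +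
        opL Pr (Gam A B K) (fderiv ℝ (PK Pr A B Q R) K E) := by
  obtain ⟨hd, hev⟩ := PK_differentiableAt Q R hst
  have hspec := hev.self_of_nhds
  set D := fderiv ℝ (PK Pr A B Q R) K E with hD
  have hcurve : HasDerivAt (fun t : ℝ => K + t • E) E 0 := curve_deriv K E
  have hder : HasDerivAt (fun t : ℝ => PK Pr A B Q R (K + t • E)) D 0 := by
    have h0 : HasFDerivAt (PK Pr A B Q R) (fderiv ℝ (PK Pr A B Q R) K) (K + (0 : ℝ) • E) := by
      simpa using hd.hasFDerivAt
    exact h0.comp_hasDerivAt (0 : ℝ) hcurve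
  have hslope := hasDerivAt_iff_tendsto_slope_zero.1 hder
  simp only [zero_add, zero_smul, add_zero] at hslope
  set s : ℝ → Fin N → Matrix (Fin d) (Fin d) ℝ :=
    fun t => t⁻¹ • (PK Pr A B Q R (K + t • E) - PK Pr A B Q R K) with hs
  have hent : ∀ i a b, Tendsto (fun t => s t i a b) (𝓝[≠] 0) (𝓝 (D i a b)) := fun i a b =>
    tendsto_pi_nhds.1 (tendsto_pi_nhds.1 (tendsto_pi_nhds.1 hslope i) a) b
  have hev0 : ∀ᶠ t : ℝ in 𝓝[≠] 0,
      IsLyap Pr A B Q R (K + t • E) (PK Pr A B Q R (K + t • E)) := by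
    have hc : Tendsto (fun t : ℝ => K + t • E) (𝓝 0) (𝓝 K) := curve_tendsto K E
    exact (hc.eventually hev).filter_mono nhdsWithin_le_nhds
  funext i
  have hid : ∀ᶠ t : ℝ in 𝓝[≠] 0, s t i =
      (E i)ᵀ * LK Pr A B Q R K i + (LK Pr A B Q R K i)ᵀ * E i
      + t • ((E i)ᵀ * (R i + (B i)ᵀ * opE Pr (PK Pr A B Q R K) i * B i) * E i)
      + opL Pr (Gam A B (K + t • E)) (s t) i := by
    filter_upwards [hev0, self_mem_nhdsWithin] with t ht ht0
    have ht0' : t ≠ 0 := ht0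
    have h := diff_identity hR hPs hspec ht i
    have hL : opL Pr (Gam A B (K + t • E)) (s t) =
        t⁻¹ • opL Pr (Gam A B (K + t • E)) (PK Pr A B Q R (K + t • E) - PK Pr A B Q R K) :=
      map_smul (linL Pr (Gam A B (K + t • E))) t⁻¹ _
    rw [hL]
    simp only [hs, Pi.smul_apply, Pi.sub_apply]
    rw [h]
    have e1 : (K + t • E) i - K i = t • E i := by simp
    simp only [e1, LK, smul_add, Matrix.transpose_smul, Matrix.smul_mul,
      Matrix.mul_smul, smul_smul, inv_mul_cancel₀ ht0', one_smul]
    rw [← mul_assoc, inv_mul_cancel₀ ht0', one_mul]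
  ext a b
  refine tendsto_nhds_unique (hent i a b) ?_
  have hlim : Tendsto (fun t : ℝ => ((E i)ᵀ * LK Pr A B Q R K i + (LK Pr A B Q R K i)ᵀ * E i
      + t • ((E i)ᵀ * (R i + (B i)ᵀ * opE Pr (PK Pr A B Q R K) i * B i) * E i)
      + opL Pr (Gam A B (K + t • E)) (s t) i) a b) (𝓝[≠] 0)
      (𝓝 (((E i)ᵀ * LK Pr A B Q R K i + (LK Pr A B Q R K i)ᵀ * E i
      + (0 : ℝ) • ((E i)ᵀ * (R i + (B i)ᵀ * opE Pr (PK Pr A B Q R K) i * B i) * E i)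
      + opL Pr (Gam A B (K + (0 : ℝ) • E)) D i) a b)) := by
    have ht : Tendsto (fun t : ℝ => t) (𝓝[≠] 0) (𝓝 0) := nhdsWithin_le_nhds
    have hG : ∀ x y, Tendsto (fun t : ℝ => Gam A B (K + t • E) i x y) (𝓝[≠] 0)
        (𝓝 (Gam A B (K + (0 : ℝ) • E) i x y)) := by
      intro x y
      simp only [Gam, Matrix.sub_apply, Matrix.mul_apply, Pi.add_apply, Pi.smul_apply,
        Matrix.add_apply, Matrix.smul_apply, smul_eq_mul]
      exact tendsto_const_nhds.sub (tendsto_finsetSum _ fun z _ =>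
        tendsto_const_nhds.mul (tendsto_const_nhds.add (ht.mul_const _)))
    have hE : ∀ x y, Tendsto (fun t : ℝ => opE Pr (s t) i x y) (𝓝[≠] 0)
        (𝓝 (opE Pr D i x y)) := by
      intro x y
      simp only [opE, Matrix.sum_apply, Matrix.smul_apply]
      exact tendsto_finsetSum _ fun j _ => (hent j x y).const_smul _
    simp only [Matrix.add_apply, Matrix.smul_apply]
    refine (tendsto_const_nhds.add (ht.smul_const _)).add ?_
    simp only [opL, Matrix.mul_apply, Matrix.transpose_apply]
    exact tendsto_finsetSum _ fun y _ => (tendsto_finsetSum _ fun x _ =>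
      (hG _ _).mul (hE _ _)).mul (hG _ _)
  rw [zero_smul, zero_smul, add_zero, add_zero] at hlim
  refine hlim.congr' ?_
  filter_upwards [hid] with t ht
  rw [ht]

/-- The linear functional `P ↦ ∑ π_i tr(P_i Σ)`. -/
def costLin {d N : ℕ} (piv : Fin N → ℝ) (Sg : Matrix (Fin d) (Fin d) ℝ) :
    (Fin N → Matrix (Fin d) (Fin d) ℝ) →ₗ[ℝ] ℝ where
  toFun V := ∑ i, piv i * (V i * Sg).trace
  map_add' V W := by simp [Matrix.add_mul, mul_add, Finset.sum_add_distrib]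
  map_smul' c V := by
    simp only [Pi.smul_apply, Matrix.smul_mul, Matrix.trace_smul, smul_eq_mul, RingHom.id_apply,
      Finset.mul_sum]
    exact Finset.sum_congr rfl fun i _ => by ring

lemma hasFDerivAt_lin {X W : Type} [NormedAddCommGroup X] [NormedSpace ℝ X]
    [NormedAddCommGroup W] [NormedSpace ℝ W] [FiniteDimensional ℝ W] (f : W →ₗ[ℝ] ℝ)
    {g : X → W} {x : X} (hg : DifferentiableAt ℝ g x) (e : X) :
    fderiv ℝ (fun y => f (g y)) x e = f (fderiv ℝ g x e) := by
  have h := (LinearMap.toContinuousLinearMap f).hasFDerivAt.comp x hg.hasFDerivAt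
  have h2 : HasFDerivAt (fun y => f (g y))
    ((LinearMap.toContinuousLinearMap f).comp (fderiv ℝ g x)) x := h
  rw [h2.fderiv]
  rfl

lemma fderiv_cost {d k N : ℕ} {Pr : Matrix (Fin N) (Fin N) ℝ}
    {A : Fin N → Matrix (Fin d) (Fin d) ℝ} {B : Fin N → Matrix (Fin d) (Fin k) ℝ}
    {Q : Fin N → Matrix (Fin d) (Fin d) ℝ} {R : Fin N → Matrix (Fin k) (Fin k) ℝ}
    (piv : Fin N → ℝ) (Sg : Matrix (Fin d) (Fin d) ℝ) {K : Fin N → Matrix (Fin k) (Fin d) ℝ}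
    (hst : Stab Pr (Gam A B K)) (E : Fin N → Matrix (Fin k) (Fin d) ℝ) :
    fderiv ℝ (cost Pr A B Q R piv Sg) K E =
      costLin piv Sg (fderiv ℝ (PK Pr A B Q R) K E) :=
  hasFDerivAt_lin (costLin piv Sg) (PK_differentiableAt Q R hst).1 E

lemma costLin_nonneg {d N : ℕ} {piv : Fin N → ℝ} (hpiv : ∀ i, 0 < piv i)
    {Sg : Matrix (Fin d) (Fin d) ℝ} (hSg : Sg.PosDef) {V : Fin N → Matrix (Fin d) (Fin d) ℝ}
    (hV : ∀ i, (V i).PosSemidef) : 0 ≤ costLin piv Sg V := by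
  change 0 ≤ ∑ i, piv i * (V i * Sg).trace
  exact Finset.sum_nonneg fun i _ => mul_nonneg (hpiv i).le (trace_mul_nonneg (hV i) hSg.posSemidef)

end DiffAux

attribute [local instance] Matrix.normedAddCommGroup Matrix.normedSpace

/-- stationary points are globally optimal. -/
theorem stationary_points_global_optimal
    (d k N : ℕ) (hd : 0 < d) (hk : 0 < k) (hN : 0 < N)
    (A : Fin N → Matrix (Fin d) (Fin d) ℝ) (B : Fin N → Matrix (Fin d) (Fin k) ℝ)
    (Pr : Matrix (Fin N) (Fin N) ℝ)
    (hPr : ∀ i j, 0 ≤ Pr i j) (hPrSum : ∀ i, ∑ j, Pr i j = 1)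
    (piv : Fin N → ℝ) (hpiv : ∀ i, 0 < piv i) (hpivSum : ∑ i, piv i = 1)
    (Sg : Matrix (Fin d) (Fin d) ℝ) (hSg : Sg.PosDef)
    (Q : Fin N → Matrix (Fin d) (Fin d) ℝ) (hQ : ∀ i, (Q i).PosDef)
    (R : Fin N → Matrix (Fin k) (Fin k) ℝ) (hR : ∀ i, (R i).PosDef)
    (K : Fin N → Matrix (Fin k) (Fin d) ℝ) (hK : MSS Pr A B K)
    (hgrad : ∀ E : Fin N → Matrix (Fin k) (Fin d) ℝ, fderiv ℝ (cost Pr A B Q R piv Sg) K E = 0) :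
    (∀ i, LK Pr A B Q R K i = 0) ∧
    (∀ i, PK Pr A B Q R K i
        = Q i + (A i)ᵀ * opE Pr (PK Pr A B Q R K) i * A i
          - (A i)ᵀ * opE Pr (PK Pr A B Q R K) i * B i
            * (R i + (B i)ᵀ * opE Pr (PK Pr A B Q R K) i * B i)⁻¹
            * ((B i)ᵀ * opE Pr (PK Pr A B Q R K) i * A i)) ∧
    ∀ K' : Fin N → Matrix (Fin k) (Fin d) ℝ, MSS Pr A B K' → cost Pr A B Q R piv Sg K ≤ cost Pr A B Q R piv Sg K' := by
  have hst := stab_of_MSS hK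
  have hspec := (PK_differentiableAt Q R hst).2.self_of_nhds
  have hRt : ∀ i, (R i)ᵀ = R i := fun i => by simpa using (hR i).1.eq
  have hPpsd := lyap_psd hPr hQ hR hst hspec
  have hEpsd : ∀ i, (opE Pr (PK Pr A B Q R K) i).PosSemidef := fun i =>
    Matrix.posSemidef_sum _ fun j _ => (hPpsd j).smul (hPr i j)
  have hEt : ∀ i, (opE Pr (PK Pr A B Q R K) i)ᵀ = opE Pr (PK Pr A B Q R K) i := fun i => by
    simpa using (hEpsd i).1.eq
  have hRh : ∀ i, (R i + (B i)ᵀ * opE Pr (PK Pr A B Q R K) i * B i).PosDef := fun i => by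
    refine (hR i).add_posSemidef ?_
    simpa using (hEpsd i).conjTranspose_mul_mul_same (B i)
  have hL : ∀ i, LK Pr A B Q R K i = 0 := by
    set L := LK Pr A B Q R K with hLdef
    set D := fderiv ℝ (PK Pr A B Q R) K L with hD
    have hDeq : D = (fun i => (L i)ᵀ * L i + (L i)ᵀ * L i) + opL Pr (Gam A B K) D :=
      deriv_eq hRt hst hEt L
    have hSp : ∀ i, ((L i)ᵀ * L i).PosSemidef := fun i => by
      simpa using Matrix.posSemidef_conjTranspose_mul_self (L i)
    have hDp := psd_of_fix hPr hst (fun i => (hSp i).add (hSp i)) hDeq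
    have h0 : costLin piv Sg D = 0 := by
      rw [hD, ← fderiv_cost piv Sg hst]
      exact hgrad L
    have h1 : costLin piv Sg (opL Pr (Gam A B K) D) ≥ 0 :=
      costLin_nonneg hpiv hSg (opL_psd hPr _ hDp)
    have h2 : costLin piv Sg (fun i => (L i)ᵀ * L i) ≥ 0 := costLin_nonneg hpiv hSg hSp
    have h3 : costLin piv Sg (fun i => (L i)ᵀ * L i + (L i)ᵀ * L i) =
        costLin piv Sg (fun i => (L i)ᵀ * L i) + costLin piv Sg (fun i => (L i)ᵀ * L i) :=
      map_add (costLin piv Sg) (fun i => (L i)ᵀ * L i) (fun i => (L i)ᵀ * L i)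
    rw [hDeq, map_add, h3] at h0
    have h4 : costLin piv Sg (fun i => (L i)ᵀ * L i) = 0 := by linarith
    have h5 : ∑ i, piv i * ((L i)ᵀ * L i * Sg).trace = 0 := h4
    rw [Finset.sum_eq_zero_iff_of_nonneg fun i _ =>
      mul_nonneg (hpiv i).le (trace_mul_nonneg (hSp i) hSg.posSemidef)] at h5
    intro i
    refine eq_zero_of_trace hSg ?_
    exact (mul_eq_zero.1 (h5 i (Finset.mem_univ i))).resolve_left (hpiv i).ne'
  refine ⟨hL, fun i => ?_, fun K' hK' => ?_⟩
  · have hLi : (R i + (B i)ᵀ * opE Pr (PK Pr A B Q R K) i * B i) * K i =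
        (B i)ᵀ * opE Pr (PK Pr A B Q R K) i * A i := sub_eq_zero.1 (hL i)
    have hu : IsUnit (R i + (B i)ᵀ * opE Pr (PK Pr A B Q R K) i * B i).det :=
      (Matrix.isUnit_iff_isUnit_det _).1 (hRh i).isUnit
    rw [Matrix.mul_assoc _ (R i + _)⁻¹, ← hLi, Matrix.nonsing_inv_mul_cancel_left _ _ hu]
    have h1 := hspec i
    have h2 : (K i)ᵀ * ((R i + (B i)ᵀ * opE Pr (PK Pr A B Q R K) i * B i) * K i) =
        (K i)ᵀ * ((B i)ᵀ * opE Pr (PK Pr A B Q R K) i * A i) := by rw [hLi]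
    generalize opE Pr (PK Pr A B Q R K) i = X at h1 h2 ⊢
    rw [h1]
    simp only [Gam, Matrix.transpose_sub, Matrix.transpose_mul, Matrix.mul_sub, Matrix.sub_mul,
      Matrix.mul_add, Matrix.add_mul, Matrix.mul_assoc] at h2 ⊢
    rw [← h2]
    abel
  · have hst' := stab_of_MSS hK'
    have hspec' := (PK_differentiableAt Q R hst').2.self_of_nhds
    have hfix : PK Pr A B Q R K' - PK Pr A B Q R K =
        (fun i => (K' i - K i)ᵀ * (R i + (B i)ᵀ * opE Pr (PK Pr A B Q R K) i * B i) *
          (K' i - K i)) +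
        opL Pr (Gam A B K') (PK Pr A B Q R K' - PK Pr A B Q R K) := by
      funext i
      have h := diff_identity hRt hEt hspec hspec' i
      have hLi : (R i + (B i)ᵀ * opE Pr (PK Pr A B Q R K) i * B i) * K i -
        (B i)ᵀ * opE Pr (PK Pr A B Q R K) i * A i = 0 := hL i
      rw [hLi] at h
      simpa using h
    have hp := psd_of_fix hPr hst' (fun i => by
      simpa using (hRh i).posSemidef.conjTranspose_mul_mul_same (K' i - K i)) hfix
    have h := costLin_nonneg hpiv hSg hp
    rw [map_sub] at h
    exact sub_nonneg.1 h

end MJLS
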